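/- Assume 2r < σ². For every x > 0 and every t ≥ 0, the Azéma supermartingale of the last exit time θ = sup{t ≥ 0 : X^x_t ≥ L} satisfies, almost surely, P(θ > t | F_t) = P(sup_{u ≥ t} X^x_u ≥ L | F_t) = min{(L/X^x_t)^α, 1}. -/

import Mathlib

open MeasureTheory ProbabilityTheory Real Set Filter

noncomputable section

/-- Geometric Brownian motion with parameters `r`, `σ`, started at `x`,
driven by the process `W`: `X^x_t = x · exp((r - σ²/2)t + σ W_t)`. -/
def GBM {Ω : Type} (r σ x : ℝ) (W : ℝ → Ω → ℝ) (t : ℝ) (ω : Ω) : ℝ :=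
  x * Real.exp ((r - σ ^ 2 / 2) * t + σ * W t ω)

/-- `W` is a standard Brownian motion with respect to the filtration `F` under the
probability measure `P`: it starts at `0`, has continuous paths, is adapted to `F`,
has Gaussian increments `W t - W s ∼ N(0, t - s)`, and its increments after time `s`
are independent of `F s`. -/
structure IsStdBM {Ω : Type} [mΩ : MeasurableSpace Ω] (P : Measure Ω)
    (F : Filtration ℝ mΩ) (W : ℝ → Ω → ℝ) : Prop where
  init : ∀ ω, W 0 ω = 0
  cont : ∀ ω, Continuous fun t => W t ω
  adapted : ∀ t : ℝ, Measurable[F t] (W t)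
  incr_law : ∀ s t : ℝ, 0 ≤ s → s ≤ t →
      Measure.map (fun ω => W t ω - W s ω) P = gaussianReal 0 (Real.toNNReal (t - s))
  incr_indep : ∀ s t : ℝ, 0 ≤ s → s ≤ t →
      Indep (MeasurableSpace.comap (fun ω => W t ω - W s ω) Real.measurableSpace) (F s) P

/-- Nonnegative continuous martingale on `[0,∞)` tending to zero in probability. -/
structure PosCM {Ω : Type} [mΩ : MeasurableSpace Ω] (P : Measure Ω)
    (F : Filtration ℝ mΩ) (N : ℝ → Ω → ℝ) : Prop where
  nonneg : ∀ u ω, 0 ≤ N u ω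
  cont : ∀ ω, Continuous fun u => N u ω
  adapted : ∀ u, Measurable[F u] (N u)
  integ : ∀ u, 0 ≤ u → Integrable (N u) P
  mart : ∀ s u, 0 ≤ s → s ≤ u → P[N u | F s] =ᵐ[P] N s
  lim : Tendsto (fun u => ∫ ω, min (N u ω) 1 ∂P) atTop (nhds 0)

lemma PosCM.disc {Ω : Type} [mΩ : MeasurableSpace Ω] {P : Measure Ω} [IsProbabilityMeasure P]
    {F : Filtration ℝ mΩ} {N : ℝ → Ω → ℝ} (h : PosCM P F N) {t : ℝ} (ht : 0 ≤ t) (m n : ℕ) :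
    ∃ (S : Ω → ℝ) (𝓜 : {m' : MeasurableSpace Ω // m' ≤ mΩ}), F t ≤ 𝓜.1 ∧
      S =ᵐ[P] P[N (t + m) | 𝓜.1] ∧
      Measurable S ∧ (∀ ω, 0 ≤ S ω) ∧
      (∀ ω, (∃ k : ℕ, k ≤ m * 2 ^ n ∧ 1 < N (t + k / 2 ^ n) ω) → 1 < S ω) ∧
      (∀ ω, (∀ u, t ≤ u → N u ω ≤ 1) → S ω = N (t + m) ω) ∧
      (∀ ω, N t ω ≤ 1 → S ω ≤ 1 ∨ ∃ k : ℕ, k < m * 2 ^ n ∧ N (t + k / 2 ^ n) ω ≤ 1 ∧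
        S ω = N (t + ((k + 1 : ℕ) : ℝ) / 2 ^ n) ω) := by
  let g : ℕ → ℝ := fun k => t + k / 2 ^ n
  have hg : Monotone g := fun a b hab => by
    have : (a : ℝ) ≤ b := by exact_mod_cast hab
    simp only [g]; gcongr
  have hgt : ∀ k, t ≤ g k := fun k => by simp only [g]; have : (0:ℝ) ≤ k / 2 ^ n := by positivity
                                         linarith
  let G : Filtration ℕ mΩ := ⟨fun k => F (g k), fun a b hab => F.mono (hg hab), fun k => F.le _⟩
  let D : ℕ → Ω → ℝ := fun k => N (g k)
  have hD : Martingale D G P := by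
    refine ⟨fun k => (h.adapted (g k)).stronglyMeasurable, fun i j hij => ?_⟩
    exact h.mart _ _ (ht.trans (hgt i)) (hg hij)
  let M := m * 2 ^ n
  let τ := hittingBtwn D (Ioi 1) 0 M
  have hτ : IsStoppingTime G (fun ω => (τ ω : WithTop ℕ)) :=
    Adapted.isStoppingTime_hittingBtwn (fun k => h.adapted (g k)) measurableSet_Ioi
  have hτM : ∀ ω, τ ω ≤ M := fun ω => hittingBtwn_le ω
  have hτM' : ∀ ω, ((τ ω : ℕ) : WithTop ℕ) ≤ (M : ℕ) := fun ω => by exact_mod_cast hτM ω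
  have hgM : g M = t + m := by simp [g, M]
  refine ⟨fun ω => D (τ ω) ω, ⟨hτ.measurableSpace, hτ.measurableSpace_le⟩, ?_, ?_, ?_, ?_, ?_, ?_, ?_⟩
  · have h0 : g 0 = t := by simp [g]
    have := hτ.le_measurableSpace_of_const_le (i := 0) (fun ω => by simp)
    change F (g 0) ≤ _ at this
    rwa [h0] at this
  · have := hD.stoppedValue_ae_eq_condExp_of_le_const hτ hτM'
    rw [← hgM]
    exact this
  · have : (fun ω => D (τ ω) ω) = fun ω => ∑ k ∈ Finset.range (M + 1),
        Set.indicator {ω | τ ω = k} (D k) ω := by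
      ext ω
      rw [Finset.sum_eq_single (τ ω)]
      · simp
      · intro b _ hb; simp [Set.indicator, hb.symm]
      · intro hh; exact absurd (Finset.mem_range.2 (Nat.lt_succ_of_le (hτM ω))) hh
    rw [this]
    refine Finset.measurable_sum _ fun k _ => ?_
    refine Measurable.indicator ((h.adapted _).mono (F.le _) le_rfl) ?_
    have := G.le _ _ (hτ.measurableSet_eq k)
    simpa using this
  · intro ω; exact h.nonneg _ _
  · rintro ω ⟨k, hk, hk1⟩
    exact hittingBtwn_mem_set (u := D) (s := Ioi 1) (n := 0) (m := M) ⟨k, ⟨Nat.zero_le _, hk⟩, hk1⟩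
  · intro ω hω
    have : τ ω = M := by
      refine hittingBtwn_eq_end_iff.2 ?_
      rintro ⟨j, -, hj⟩
      exact absurd (hω _ (hgt j)) (not_le.2 hj)
    simp only [this, D, hgM]
  · intro ω hω
    by_cases h1 : D (τ ω) ω ≤ 1
    · exact Or.inl h1
    right
    have h0 : τ ω ≠ 0 := by
      intro h0
      apply h1
      simpa [h0, D, g] using hω
    obtain ⟨k, hk⟩ := Nat.exists_eq_succ_of_ne_zero h0
    refine ⟨k, ?_, ?_, ?_⟩
    · have := hτM ω; change k < M; omega
    · have := notMem_of_lt_hittingBtwn (u := D) (s := Ioi 1) (n := 0) (m := M) (ω := ω) (k := k)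
        (by change k < τ ω; omega) (Nat.zero_le _)
      simpa [D, g] using this
    · simp only [hk, D, g, Nat.succ_eq_add_one]

lemma PosCM.setIntegral {Ω : Type} [mΩ : MeasurableSpace Ω] {P : Measure Ω} [IsProbabilityMeasure P]
    {F : Filtration ℝ mΩ} {N : ℝ → Ω → ℝ} (h : PosCM P F N) {t : ℝ} (ht : 0 ≤ t) (m : ℕ)
    {S : Ω → ℝ} {𝓜 : {m' : MeasurableSpace Ω // m' ≤ mΩ}} (hle : F t ≤ 𝓜.1)
    (hS : S =ᵐ[P] P[N (t + m) | 𝓜.1]) {A : Set Ω} (hA : MeasurableSet[F t] A) :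
    ∫ ω in A, N t ω ∂P = ∫ ω in A, S ω ∂P := by
  have hm : (0:ℝ) ≤ m := by positivity
  have hi : Integrable (N (t + m)) P := h.integ _ (by linarith)
  calc ∫ ω in A, N t ω ∂P = ∫ ω in A, (P[N (t + m) | F t]) ω ∂P :=
        (setIntegral_congr_ae (F.le t A hA) ((h.mart t (t + m) ht (by linarith)).mono
          fun ω hω _ => hω)).symm
    _ = ∫ ω in A, N (t + m) ω ∂P := setIntegral_condExp (F.le t) hi hA
    _ = ∫ ω in A, (P[N (t + m) | 𝓜.1]) ω ∂P := (setIntegral_condExp 𝓜.2 hi (hle _ hA)).symm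
    _ = ∫ ω in A, S ω ∂P := setIntegral_congr_ae (F.le t A hA) (hS.mono fun ω hω _ => hω.symm)

lemma PosCM.exists_grid {Ω : Type} {N : ℝ → Ω → ℝ} (hc : ∀ ω, Continuous fun u => N u ω)
    {t : ℝ} {ω : Ω} (hω : ∃ u, t ≤ u ∧ 1 < N u ω) :
    ∃ n k : ℕ, k ≤ n * 2 ^ n ∧ 1 < N (t + k / 2 ^ n) ω := by
  obtain ⟨u, hu, h1⟩ := hω
  have hlim : Tendsto (fun n : ℕ => t + (⌊(u - t) * 2 ^ n⌋₊ : ℝ) / 2 ^ n) atTop (nhds u) := by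
    have h2 : Tendsto (fun n : ℕ => (2:ℝ) ^ n) atTop atTop :=
      tendsto_pow_atTop_atTop_of_one_lt (by norm_num)
    have h3 := (tendsto_nat_floor_mul_div_atTop (R := ℝ) (sub_nonneg.2 hu)).comp h2
    have := h3.const_add t
    simpa using this
  have hev := ((hc ω).tendsto u).comp hlim |>.eventually (lt_mem_nhds h1)
  obtain ⟨n, hn, hn2⟩ := (hev.and (eventually_ge_atTop ⌈u - t⌉₊)).exists
  refine ⟨n, ⌊(u - t) * 2 ^ n⌋₊, ?_, hn⟩
  have : u - t ≤ n := (Nat.le_ceil _).trans (by exact_mod_cast hn2)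
  refine Nat.floor_le_of_le ?_
  push_cast
  gcongr

lemma PosCM.measurable_hit {Ω : Type} [mΩ : MeasurableSpace Ω] {P : Measure Ω}
    {F : Filtration ℝ mΩ} {N : ℝ → Ω → ℝ} (h : PosCM P F N) (t : ℝ) :
    MeasurableSet {ω | ∃ u, t ≤ u ∧ 1 < N u ω} := by
  have : {ω | ∃ u, t ≤ u ∧ 1 < N u ω} = ⋃ n : ℕ, ⋃ k : ℕ, {ω | 1 < N (t + k / 2 ^ n) ω} := by
    ext ω
    simp only [mem_ofPred_eq, mem_iUnion]
    constructor
    · intro hω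
      obtain ⟨n, k, -, hk⟩ := PosCM.exists_grid h.cont hω
      exact ⟨n, k, hk⟩
    · rintro ⟨n, k, hk⟩
      exact ⟨_, by have : (0:ℝ) ≤ k / 2 ^ n := by positivity
                   linarith, hk⟩
  rw [this]
  exact .iUnion fun n => .iUnion fun k =>
    measurableSet_lt measurable_const ((h.adapted _).mono (F.le _) le_rfl)

lemma setIntegral_ind {Ω : Type} [mΩ : MeasurableSpace Ω] {P : Measure Ω} [IsProbabilityMeasure P]
    {A E : Set Ω} (hA : MeasurableSet A) (hE : MeasurableSet E) :
    ∫ ω in A, E.indicator (fun _ => (1:ℝ)) ω ∂P = P.real (A ∩ E) := by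
  rw [integral_indicator hE, setIntegral_const, smul_eq_mul, mul_one, Measure.real,
    Measure.restrict_apply' hA, Measure.real, inter_comm]

lemma PosCM.doob {Ω : Type} [mΩ : MeasurableSpace Ω] {P : Measure Ω} [IsProbabilityMeasure P]
    {F : Filtration ℝ mΩ} {N : ℝ → Ω → ℝ} (h : PosCM P F N) {t : ℝ} (ht : 0 ≤ t)
    {A : Set Ω} (hA : MeasurableSet[F t] A) :
    P.real (A ∩ {ω | ∃ u, t ≤ u ∧ 1 < N u ω}) ≤ ∫ ω in A, N t ω ∂P := by
  let E : ℕ → Set Ω := fun n => {ω | ∃ k : ℕ, k ≤ n * 2 ^ n ∧ 1 < N (t + k / 2 ^ n) ω}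
  have hA' := F.le t A hA
  have hEm : ∀ n, MeasurableSet (E n) := by
    intro n
    have : E n = ⋃ k : ℕ, ⋃ (_ : k ≤ n * 2 ^ n), {ω | 1 < N (t + k / 2 ^ n) ω} := by
      ext ω; simp [E]
    rw [this]
    exact .iUnion fun n => .iUnion fun k =>
      measurableSet_lt measurable_const ((h.adapted _).mono (F.le _) le_rfl)
  have hmono : Monotone fun n => A ∩ E n := by
    refine monotone_nat_of_le_succ fun n => inter_subset_inter_right _ ?_
    rintro ω ⟨k, hk, hk1⟩
    refine ⟨2 * k, ?_, ?_⟩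
    · calc 2 * k ≤ 2 * (n * 2 ^ n) := by omega
        _ = n * 2 ^ (n + 1) := by ring
        _ ≤ _ := by gcongr; omega
    · have : ((2 * k : ℕ) : ℝ) / 2 ^ (n + 1) = k / 2 ^ n := by
        push_cast; field_simp; ring
      rwa [this]
  have hU : A ∩ {ω | ∃ u, t ≤ u ∧ 1 < N u ω} ⊆ ⋃ n, A ∩ E n := by
    rintro ω ⟨h1, h2⟩
    obtain ⟨n, k, hk⟩ := PosCM.exists_grid h.cont h2
    exact mem_iUnion.2 ⟨n, h1, k, hk⟩
  have hb : ∀ n, P.real (A ∩ E n) ≤ ∫ ω in A, N t ω ∂P := by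
    intro n
    obtain ⟨S, 𝓜, hle, hS, hSm, hS0, hS1, -, -⟩ := h.disc ht n n
    rw [h.setIntegral ht n hle hS hA]
    have hSi : Integrable S P := integrable_condExp.congr hS.symm
    calc P.real (A ∩ E n) = ∫ ω in A, (E n).indicator (fun _ => (1:ℝ)) ω ∂P := by
          rw [setIntegral_ind hA' (hEm n)]
      _ ≤ _ := by
          refine integral_mono ((integrable_const _).indicator (hEm n)) hSi.integrableOn fun ω => ?_
          by_cases hω : ω ∈ E n
          · simpa [hω] using (hS1 ω hω).le
          · simpa [hω] using hS0 ω
  have htend := tendsto_measure_iUnion_atTop (μ := P) hmono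
  have htend' : Tendsto (fun n => P.real (A ∩ E n)) atTop (nhds (P.real (⋃ n, A ∩ E n))) :=
    (ENNReal.tendsto_toReal (measure_ne_top _ _)).comp htend
  exact (measureReal_mono hU).trans (le_of_tendsto' htend' hb)

lemma PosCM.integrable_min {Ω : Type} [mΩ : MeasurableSpace Ω] {P : Measure Ω} [IsProbabilityMeasure P]
    {F : Filtration ℝ mΩ} {N : ℝ → Ω → ℝ} (h : PosCM P F N) (t : ℝ) :
    Integrable (fun ω => min (N t ω) 1) P := by
  refine Integrable.of_bound (C := 1) ?_ ?_
  · exact (((h.adapted t).mono (F.le t) le_rfl).min measurable_const).aestronglyMeasurable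
  · refine ae_of_all _ fun ω => ?_
    rw [Real.norm_eq_abs, abs_of_nonneg (le_min (h.nonneg _ _) zero_le_one)]
    exact min_le_right _ _

lemma PosCM.lower {Ω : Type} [mΩ : MeasurableSpace Ω] {P : Measure Ω} [IsProbabilityMeasure P]
    {F : Filtration ℝ mΩ} {N : ℝ → Ω → ℝ} (h : PosCM P F N) {t : ℝ} (ht : 0 ≤ t)
    {A : Set Ω} (hA : MeasurableSet[F t] A) (hA1 : ∀ ω ∈ A, N t ω ≤ 1) :
    ∫ ω in A, N t ω ∂P ≤ P.real (A ∩ {ω | ∃ u, t ≤ u ∧ 1 < N u ω}) := by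
  set E := {ω | ∃ u, t ≤ u ∧ 1 < N u ω} with hE
  have hEm : MeasurableSet E := h.measurable_hit t
  have hA' := F.le t A hA
  have key : ∀ m : ℕ, ∫ ω in A, N t ω ∂P ≤ P.real (A ∩ E) + ∫ ω, min (N (t + m) ω) 1 ∂P := by
    intro m
    choose S 𝓜 hle hS hSm hS0 _ hS2 hS3 using fun n => h.disc ht m n
    have hi : Integrable (N (t + m)) P := h.integ _ (by positivity)
    have hSi : ∀ n, Integrable (S n) P := fun n => integrable_condExp.congr (hS n).symm
    let V : ℕ → Ω → ℝ := fun n => A.indicator fun ω => max (S n ω - 1) 0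
    have hVm : ∀ n, Measurable (V n) := fun n =>
      (((hSm n).sub_const 1).max measurable_const).indicator hA'
    have hV0 : ∀ n ω, 0 ≤ V n ω := fun n ω => indicator_nonneg (fun _ _ => le_max_right _ _) _
    have hVS : ∀ n ω, V n ω ≤ S n ω := by
      intro n ω
      by_cases hω : ω ∈ A
      · simp only [V, hω, indicator_of_mem]
        exact max_le (by linarith) (hS0 n ω)
      · simpa [V, hω] using hS0 n ω
    have hVi : ∀ n, Integrable (V n) P := fun n =>
      (hSi n).mono' (hVm n).aestronglyMeasurable (ae_of_all _ fun ω => by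
        rw [Real.norm_eq_abs, abs_of_nonneg (hV0 n ω)]; exact hVS n ω)
    have hUI : UnifIntegrable V 1 P := by
      have hu := (hi.uniformIntegrable_condExp (fun n => (𝓜 n).2)).2.1
      intro ε hε
      obtain ⟨δ, hδ, hh⟩ := hu hε
      refine ⟨δ, hδ, fun n s hs hsδ => le_trans (eLpNorm_mono_ae ?_) (hh n s hs hsδ)⟩
      filter_upwards [hS n] with ω hω
      by_cases hωs : ω ∈ s
      · simp only [hωs, indicator_of_mem]
        rw [← hω, Real.norm_eq_abs, Real.norm_eq_abs, abs_of_nonneg (hV0 n ω),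
          abs_of_nonneg (hS0 n ω)]
        exact hVS n ω
      · simp [hωs]
    have hVlim : ∀ ω, Tendsto (fun n => V n ω) atTop (nhds 0) := by
      intro ω
      by_cases hω : ω ∈ A
      swap
      · simp [V, hω]
      simp only [V, hω, indicator_of_mem]
      have huc := isCompact_Icc.uniformContinuousOn_of_continuous
        ((h.cont ω).continuousOn (s := Icc t (t + m)))
      rw [Metric.uniformContinuousOn_iff] at huc
      rw [Metric.tendsto_atTop]
      intro ε hε
      obtain ⟨δ, hδ, hd⟩ := huc (ε / 2) (by positivity)
      obtain ⟨n0, hn0⟩ := exists_pow_lt_of_lt_one hδ (show (1/2 : ℝ) < 1 by norm_num)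
      refine ⟨n0, fun n hn => ?_⟩
      have hpow : (1 / 2 : ℝ) ^ n < δ :=
        lt_of_le_of_lt (pow_le_pow_of_le_one (by norm_num) (by norm_num) hn) hn0
      rw [Real.dist_eq, sub_zero, abs_of_nonneg (le_max_right _ _)]
      refine max_lt ?_ hε
      rcases hS3 n ω (hA1 ω hω) with h1 | ⟨k, hk, hk1, hk2⟩
      · linarith
      rw [hk2]
      have hp : (0:ℝ) < 2 ^ n := by positivity
      have hkm : ((k + 1 : ℕ) : ℝ) / 2 ^ n ≤ m := by
        rw [div_le_iff₀ hp]; exact_mod_cast hk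
      have hkk : (k : ℝ) / 2 ^ n + (1 / 2) ^ n = ((k + 1 : ℕ) : ℝ) / 2 ^ n := by
        push_cast; rw [one_div, inv_pow]; field_simp
      have hk0 : (0:ℝ) ≤ k / 2 ^ n := by positivity
      have hq : (0:ℝ) < (1/2) ^ n := by positivity
      have := hd (t + ((k + 1 : ℕ) : ℝ) / 2 ^ n) ⟨by linarith, by linarith⟩
        (t + (k : ℝ) / 2 ^ n) ⟨by linarith, by linarith⟩
        (by rw [Real.dist_eq, abs_lt]; constructor <;> linarith)
      rw [Real.dist_eq, abs_lt] at this
      linarith [this.2]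
    have hVint : Tendsto (fun n => ∫ ω, V n ω ∂P) atTop (nhds 0) := by
      have h1 := tendsto_Lp_finite_of_tendsto_ae (μ := P) (p := 1) le_rfl ENNReal.one_ne_top
        (f := V) (g := fun _ => 0) (fun n => (hVm n).aestronglyMeasurable) MemLp.zero hUI
        (ae_of_all _ hVlim)
      have h2 := tendsto_integral_of_L1' (μ := P) (F := V) (l := atTop) (fun _ => (0:ℝ))
        aestronglyMeasurable_const (Eventually.of_forall hVi) h1
      simpa using h2
    have hb : ∀ n, ∫ ω in A, N t ω ∂P ≤
        P.real (A ∩ E) + ∫ ω, min (N (t + m) ω) 1 ∂P + ∫ ω, V n ω ∂P := by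
      intro n
      have hmi := h.integrable_min (t + m)
      have hei : Integrable (E.indicator (fun _ => (1:ℝ))) P :=
        (integrable_const _).indicator hEm
      rw [h.setIntegral ht m (hle n) (hS n) hA]
      calc ∫ ω in A, S n ω ∂P
          ≤ ∫ ω in A, (E.indicator (fun _ => (1:ℝ)) ω + min (N (t + m) ω) 1 + V n ω) ∂P := by
            refine setIntegral_mono_on (hSi n).integrableOn
              ((hei.add hmi).add (hVi n)).integrableOn hA' fun ω hω => ?_
            have hVω : S n ω - 1 ≤ V n ω := by
              simp only [V, hω, indicator_of_mem]; exact le_max_left _ _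
            have hm0 : 0 ≤ min (N (t + m) ω) 1 := le_min (h.nonneg _ _) zero_le_one
            by_cases hωE : ω ∈ E
            · simp only [hωE, indicator_of_mem]; linarith
            · have hall : ∀ u, t ≤ u → N u ω ≤ 1 := fun u hu => by
                by_contra hc; exact hωE ⟨u, hu, not_le.1 hc⟩
              rw [hS2 n ω hall, min_eq_left (hall _ (by simp))]
              simp only [hωE, not_false_eq_true, indicator_of_notMem]
              linarith [hV0 n ω]
        _ = ∫ ω in A, E.indicator (fun _ => (1:ℝ)) ω ∂P + ∫ ω in A, min (N (t + m) ω) 1 ∂P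
              + ∫ ω in A, V n ω ∂P := by
            have e1 := integral_add (hei.add hmi).integrableOn (hVi n).integrableOn (μ := P.restrict A)
            have e2 := integral_add hei.integrableOn hmi.integrableOn (μ := P.restrict A)
            simp only [Pi.add_apply] at e1
            rw [e1, e2]
        _ ≤ _ := by
            rw [setIntegral_ind hA' hEm]
            have e1 := setIntegral_le_integral (s := A) hmi
                (ae_of_all _ fun ω => le_min (h.nonneg _ _) zero_le_one)
            have e2 := setIntegral_le_integral (s := A) (hVi n) (ae_of_all _ (hV0 n))
            linarith
    have := ge_of_tendsto' (hVint.const_add (P.real (A ∩ E) + ∫ ω, min (N (t + m) ω) 1 ∂P)) hb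
    simpa using this
  have hlim := (h.lim.comp (tendsto_atTop_add_const_left atTop t
    tendsto_natCast_atTop_atTop)).const_add (P.real (A ∩ E))
  simpa using ge_of_tendsto' hlim key

lemma PosCM.eq {Ω : Type} [mΩ : MeasurableSpace Ω] {P : Measure Ω} [IsProbabilityMeasure P]
    {F : Filtration ℝ mΩ} {N : ℝ → Ω → ℝ} (h : PosCM P F N) {t : ℝ} (ht : 0 ≤ t)
    {A : Set Ω} (hA : MeasurableSet[F t] A) :
    P.real (A ∩ {ω | ∃ u, t ≤ u ∧ 1 < N u ω}) = ∫ ω in A, min (N t ω) 1 ∂P := by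
  set E := {ω | ∃ u, t ≤ u ∧ 1 < N u ω} with hE
  have hEm : MeasurableSet E := h.measurable_hit t
  have hB : MeasurableSet[F t] {ω | N t ω ≤ 1} := h.adapted t measurableSet_Iic
  have hA' := F.le t A hA
  have hB' := F.le t _ hB
  have h1 : P.real ((A ∩ {ω | N t ω ≤ 1}) ∩ E) = ∫ ω in A ∩ {ω | N t ω ≤ 1}, min (N t ω) 1 ∂P := by
    have h2 : ∫ ω in A ∩ {ω | N t ω ≤ 1}, min (N t ω) 1 ∂P =
        ∫ ω in A ∩ {ω | N t ω ≤ 1}, N t ω ∂P :=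
      setIntegral_congr_fun (hA'.inter hB') fun ω hω => min_eq_left hω.2
    rw [h2]
    have hAB : MeasurableSet[F t] (A ∩ {ω | N t ω ≤ 1}) := MeasurableSet.inter hA hB
    exact le_antisymm (h.doob ht hAB) (h.lower ht hAB fun ω hω => hω.2)
  have h2 : P.real ((A \ {ω | N t ω ≤ 1}) ∩ E) = ∫ ω in A \ {ω | N t ω ≤ 1}, min (N t ω) 1 ∂P := by
    have h3 : ∫ ω in A \ {ω | N t ω ≤ 1}, min (N t ω) 1 ∂P =
        ∫ ω in A \ {ω | N t ω ≤ 1}, (1:ℝ) ∂P :=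
      setIntegral_congr_fun (hA'.diff hB') fun ω hω => min_eq_right (not_le.1 hω.2).le
    rw [h3, setIntegral_const, smul_eq_mul, mul_one, inter_eq_left.2]
    exact fun ω hω => ⟨t, le_rfl, not_le.1 hω.2⟩
  rw [← integral_inter_add_sdiff hB' (h.integrable_min t).integrableOn, ← h1, ← h2,
    ← measureReal_inter_add_sdiff (s := A ∩ E) hB']
  congr 2 <;> (ext ω; simp only [mem_inter_iff, Set.mem_sdiff]; tauto)

lemma PosCM.smul {Ω : Type} [mΩ : MeasurableSpace Ω] {P : Measure Ω} [IsProbabilityMeasure P]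
    {F : Filtration ℝ mΩ} {N : ℝ → Ω → ℝ} (h : PosCM P F N) {c : ℝ} (hc : 1 ≤ c) :
    PosCM P F (fun u ω => c * N u ω) := by
  have hc0 : 0 ≤ c := by linarith
  refine ⟨fun u ω => mul_nonneg hc0 (h.nonneg u ω), fun ω => (h.cont ω).const_mul c,
    fun u => (h.adapted u).const_mul c, fun u hu => (h.integ u hu).const_mul c, ?_, ?_⟩
  · intro s u hs hu
    have h1 := condExp_smul (μ := P) c (N u) (F s)
    filter_upwards [h1, h.mart s u hs hu] with ω h2 h3
    have : (fun ω => c * N u ω) = c • N u := rfl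
    rw [this, h2]; simp [h3]
  · have hl := h.lim.const_mul c
    rw [mul_zero] at hl
    refine squeeze_zero (fun u => integral_nonneg fun ω =>
      le_min (mul_nonneg hc0 (h.nonneg u ω)) zero_le_one) (fun u => ?_) hl
    rw [← integral_const_mul]
    refine integral_mono_of_nonneg (ae_of_all _ fun ω =>
      le_min (mul_nonneg hc0 (h.nonneg u ω)) zero_le_one) ((h.integrable_min u).const_mul c)
      (ae_of_all _ fun ω => ?_)
    change min (c * N u ω) 1 ≤ c * min (N u ω) 1
    rw [mul_min_of_nonneg _ _ hc0]
    exact min_le_min le_rfl (by linarith)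

/-- closed version of the hitting event has no more mass -/
lemma PosCM.closed_le {Ω : Type} [mΩ : MeasurableSpace Ω] {P : Measure Ω} [IsProbabilityMeasure P]
    {F : Filtration ℝ mΩ} {N : ℝ → Ω → ℝ} (h : PosCM P F N) {t : ℝ} (ht : 0 ≤ t) :
    P.real {ω | ∃ u, t ≤ u ∧ 1 ≤ N u ω} ≤ P.real {ω | ∃ u, t ≤ u ∧ 1 < N u ω} := by
  have h0 := h.eq ht (A := univ) MeasurableSet.univ
  simp only [univ_inter, Measure.restrict_univ] at h0
  rw [h0]
  set I := ∫ ω, min (N t ω) 1 ∂P with hI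
  have hc : ∀ c : ℝ, 1 < c → P.real {ω | ∃ u, t ≤ u ∧ 1 ≤ N u ω} ≤ c * I := by
    intro c hc
    have h1 := (h.smul hc.le).eq ht (A := univ) MeasurableSet.univ
    simp only [univ_inter, Measure.restrict_univ] at h1
    calc _ ≤ P.real {ω | ∃ u, t ≤ u ∧ 1 < c * N u ω} := by
          refine measureReal_mono ?_
          rintro ω ⟨u, hu, h2⟩
          exact ⟨u, hu, by nlinarith⟩
      _ ≤ _ := by
          rw [h1, hI, ← integral_const_mul]
          refine integral_mono ((h.smul hc.le).integrable_min t) ((h.integrable_min t).const_mul c)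
            fun ω => ?_
          change min (c * N t ω) 1 ≤ c * min (N t ω) 1
          rw [mul_min_of_nonneg _ _ (by linarith)]
          exact min_le_min le_rfl (by linarith)
  have ht1 : Tendsto (fun c : ℝ => c * I) (nhdsWithin 1 (Ioi 1)) (nhds (1 * I)) :=
    (tendsto_id.mul_const I).mono_left nhdsWithin_le_nhds
  rw [one_mul] at ht1
  exact ge_of_tendsto ht1 (eventually_nhdsWithin_of_forall hc)

lemma PosCM.ae_bdd {Ω : Type} [mΩ : MeasurableSpace Ω] {P : Measure Ω} [IsProbabilityMeasure P]
    {F : Filtration ℝ mΩ} {N : ℝ → Ω → ℝ} (h : PosCM P F N) :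
    ∀ᵐ ω ∂P, ∃ T : ℝ, ∀ u, T ≤ u → N u ω ≤ 1 := by
  have hz : P.real {ω | ¬ ∃ T : ℝ, ∀ u, T ≤ u → N u ω ≤ 1} ≤ 0 := by
    have hl := h.lim.comp tendsto_natCast_atTop_atTop (α := ℕ)
    refine ge_of_tendsto' hl fun n => ?_
    have h0 := h.eq (t := n) (by positivity) (A := univ) MeasurableSet.univ
    simp only [univ_inter, Measure.restrict_univ] at h0
    simp only [Function.comp]
    rw [← h0]
    refine measureReal_mono ?_
    intro ω hω
    simp only [mem_ofPred_eq, not_exists, not_forall, not_le] at hω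
    obtain ⟨u, hu, h1⟩ := hω n
    exact ⟨u, hu, h1⟩
  have hz' := le_antisymm hz measureReal_nonneg
  rw [measureReal_eq_zero_iff] at hz'
  exact hz'

lemma IsStdBM.integrable_exp {Ω : Type} [mΩ : MeasurableSpace Ω] {P : Measure Ω}
    [IsProbabilityMeasure P] {F : Filtration ℝ mΩ} {W : ℝ → Ω → ℝ} (hW : IsStdBM P F W)
    (a : ℝ) {s u : ℝ} (hs : 0 ≤ s) (hu : s ≤ u) :
    Integrable (fun ω => rexp (a * (W u ω - W s ω))) P ∧
      ∫ ω, rexp (a * (W u ω - W s ω)) ∂P = rexp (a ^ 2 / 2 * (u - s)) := by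
  have hl := hW.incr_law s u hs hu
  have hm := mgf_gaussianReal hl a
  have he : mgf (fun ω => W u ω - W s ω) P a = rexp (a ^ 2 / 2 * (u - s)) := by
    rw [hm, Real.coe_toNNReal _ (sub_nonneg.2 hu)]; congr 1; ring
  constructor
  · by_contra hc
    have : mgf (fun ω => W u ω - W s ω) P a = 0 := integral_undef hc
    rw [this] at he
    exact (Real.exp_pos _).ne he
  · exact he

lemma IsStdBM.posCM {Ω : Type} [mΩ : MeasurableSpace Ω] {P : Measure Ω} [IsProbabilityMeasure P]
    {F : Filtration ℝ mΩ} {W : ℝ → Ω → ℝ} (hW : IsStdBM P F W) {C a : ℝ} (hC : 0 < C)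
    (ha : a ≠ 0) : PosCM P F (fun u ω => C * rexp (a * W u ω - a ^ 2 / 2 * u)) := by
  have hexp : ∀ (b c : ℝ) (u : ℝ), 0 ≤ u → Integrable (fun ω => rexp (b * W u ω - c)) P ∧
      ∫ ω, rexp (b * W u ω - c) ∂P = rexp (b ^ 2 / 2 * u - c) := by
    intro b c u hu
    have h1 := hW.integrable_exp b le_rfl hu
    simp only [hW.init, sub_zero] at h1
    have h2 : (fun ω => rexp (b * W u ω - c)) = fun ω => rexp (-c) * rexp (b * W u ω) := by
      ext ω; rw [← Real.exp_add]; congr 1; ring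
    rw [h2]
    refine ⟨h1.1.const_mul _, ?_⟩
    rw [integral_const_mul, h1.2, ← Real.exp_add]; congr 1; ring
  have hmeas : ∀ u (b c d : ℝ), Measurable[F u] (fun ω => d * rexp (b * W u ω - c)) := fun u b c d =>
    (Real.measurable_exp.comp (((hW.adapted u).const_mul b).sub_const c)).const_mul d
  have hi : ∀ u, 0 ≤ u → Integrable (fun ω => C * rexp (a * W u ω - a ^ 2 / 2 * u)) P :=
    fun u hu => (hexp a _ u hu).1.const_mul C
  refine ⟨fun u ω => by positivity, fun ω => ?_, fun u => hmeas u _ _ _, hi, ?_, ?_⟩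
  · have := hW.cont ω
    fun_prop
  · intro s u hs hu
    let f : Ω → ℝ := fun ω => C * rexp (a * W s ω - a ^ 2 / 2 * u)
    let g : Ω → ℝ := fun ω => rexp (a * (W u ω - W s ω))
    have hfg : (fun ω => C * rexp (a * W u ω - a ^ 2 / 2 * u)) = f * g := by
      ext ω
      simp only [f, g, Pi.mul_apply]
      rw [mul_assoc, ← Real.exp_add]; congr 2; ring
    obtain ⟨hg1, hg2⟩ := hW.integrable_exp a hs hu
    have h1 : P[f * g | F s] =ᵐ[P] f * P[g | F s] :=
      condExp_mul_of_stronglyMeasurable_left (hmeas s _ _ _).stronglyMeasurable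
        (hfg ▸ hi u (hs.trans hu)) hg1
    have hWm : Measurable (fun ω => W u ω - W s ω) :=
      ((hW.adapted u).mono (F.le u) le_rfl).sub ((hW.adapted s).mono (F.le s) le_rfl)
    have hgm : StronglyMeasurable[MeasurableSpace.comap (fun ω => W u ω - W s ω)
        Real.measurableSpace] g := by
      refine Measurable.stronglyMeasurable ?_
      exact Real.measurable_exp.comp ((comap_measurable (fun ω => W u ω - W s ω)).const_mul a)
    have h2 : P[g | F s] =ᵐ[P] fun _ => P[g] :=
      condExp_indep_eq hWm.comap_le (F.le s) hgm (hW.incr_indep s u hs hu)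
    rw [hfg]
    filter_upwards [h1, h2] with ω e1 e2
    rw [e1, Pi.mul_apply, e2]
    simp only [f, g]
    rw [hg2, mul_assoc, ← Real.exp_add]; congr 2; ring
  · have hlim : Tendsto (fun u : ℝ => √C * rexp (-(a ^ 2 / 8 * u))) atTop (nhds 0) := by
      have h1 : Tendsto (fun u : ℝ => a ^ 2 / 8 * u) atTop atTop :=
        tendsto_id.const_mul_atTop (by positivity)
      simpa using (Real.tendsto_exp_neg_atTop_nhds_zero.comp h1).const_mul (√C)
    refine squeeze_zero' (Eventually.of_forall fun u => integral_nonneg fun ω =>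
      le_min (by positivity) zero_le_one) ?_ hlim
    filter_upwards [eventually_ge_atTop 0] with u hu
    obtain ⟨h1, h2⟩ := hexp (a / 2) (a ^ 2 / 4 * u) u hu
    have h3 : √C * rexp (-(a ^ 2 / 8 * u)) =
        ∫ ω, √C * rexp (a / 2 * W u ω - a ^ 2 / 4 * u) ∂P := by
      rw [integral_const_mul, h2]; congr 2; ring
    rw [h3]
    refine integral_mono_of_nonneg (ae_of_all _ fun ω => le_min (by positivity) zero_le_one)
      (h1.const_mul _) (ae_of_all _ fun ω => ?_)
    set z := √C * rexp (a / 2 * W u ω - a ^ 2 / 4 * u) with hz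
    have hz0 : 0 < z := by positivity
    have hzz : C * rexp (a * W u ω - a ^ 2 / 2 * u) = z * z := by
      have : rexp (a * W u ω - a ^ 2 / 2 * u) = rexp (a / 2 * W u ω - a ^ 2 / 4 * u)
          * rexp (a / 2 * W u ω - a ^ 2 / 4 * u) := by
        rw [← Real.exp_add]; congr 1; ring
      rw [hz, this]
      nth_rewrite 1 [← Real.mul_self_sqrt hC.le]
      ring
    change min (C * rexp (a * W u ω - a ^ 2 / 2 * u)) 1 ≤ z
    rw [hzz]
    rcases le_total z 1 with h | h
    · exact (min_le_left _ _).trans (by nlinarith)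
    · exact (min_le_right _ _).trans h

/-- deterministic inclusions -/
lemma path_incl (X : ℝ → ℝ) (hX : Continuous X) {L t : ℝ} (ht : 0 ≤ t) (hX0 : ∀ u, 0 < X u)
    (hb : ∃ T : ℝ, ∀ u, T ≤ u → X u ≤ L / 2) (hL : 0 < L) :
    ((∃ u, t ≤ u ∧ L < X u) → t < sSup {s : ℝ | 0 ≤ s ∧ L ≤ X s}) ∧
    (t < sSup {s : ℝ | 0 ≤ s ∧ L ≤ X s} → ∃ u, t ≤ u ∧ L ≤ X u) ∧
    ((∃ u, t ≤ u ∧ L < X u) → L ≤ ⨆ u : Ici t, X u) ∧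
    (L ≤ (⨆ u : Ici t, X u) → ∃ u, t ≤ u ∧ L ≤ X u) := by
  obtain ⟨T, hT⟩ := hb
  have hbdd : BddAbove {s : ℝ | 0 ≤ s ∧ L ≤ X s} := by
    refine ⟨T, fun s hs => ?_⟩
    by_contra hc
    have := hT s (not_le.1 hc).le
    linarith [hs.2]
  let T' := max T t
  obtain ⟨v, hv, hvmax⟩ := isCompact_Icc.exists_isMaxOn (s := Icc t T')
    ⟨t, le_rfl, le_max_right _ _⟩ hX.continuousOn
  have hle : ∀ u, t ≤ u → X u ≤ max (X v) (L / 2) := by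
    intro u hu
    rcases le_total u T' with h | h
    · exact le_max_of_le_left (hvmax ⟨hu, h⟩)
    · exact le_max_of_le_right (hT u ((le_max_left _ _).trans h))
  have hbdd2 : BddAbove (range fun u : Ici t => X u) :=
    ⟨max (X v) (L / 2), by rintro _ ⟨u, rfl⟩; exact hle u u.2⟩
  refine ⟨?_, ?_, ?_, ?_⟩
  · rintro ⟨u, hu, hLu⟩
    have hev : ∀ᶠ s in nhdsWithin u (Ioi u), L < X s :=
      (hX.tendsto u).mono_left nhdsWithin_le_nhds |>.eventually (lt_mem_nhds hLu)
    obtain ⟨s, hs1, hs2⟩ := (hev.and self_mem_nhdsWithin).exists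
    have hs2' : u < s := hs2
    exact lt_of_lt_of_le (lt_of_le_of_lt hu hs2')
      (le_csSup hbdd ⟨(ht.trans hu).trans hs2'.le, hs1.le⟩)
  · intro h
    have hne : {s : ℝ | 0 ≤ s ∧ L ≤ X s}.Nonempty := by
      by_contra hc
      rw [not_nonempty_iff_eq_empty] at hc
      rw [hc, Real.sSup_empty] at h
      linarith
    obtain ⟨s, hs, hts⟩ := exists_lt_of_lt_csSup hne h
    exact ⟨s, hts.le, hs.2⟩
  · rintro ⟨u, hu, hLu⟩
    exact hLu.le.trans (le_ciSup hbdd2 ⟨u, hu⟩)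
  · intro h
    have : Nonempty (Ici t) := ⟨⟨t, self_mem_Ici⟩⟩
    have h2 : (⨆ u : Ici t, X u) ≤ max (X v) (L / 2) := ciSup_le fun u => hle u u.2
    rcases le_max_iff.1 (h.trans h2) with h3 | h3
    · exact ⟨v, hv.1, h3⟩
    · linarith

lemma PosCM.ae_eq_of_between {Ω : Type} [mΩ : MeasurableSpace Ω] {P : Measure Ω}
    [IsProbabilityMeasure P]
    {F : Filtration ℝ mΩ} {N : ℝ → Ω → ℝ} (h : PosCM P F N) {t : ℝ} (ht : 0 ≤ t) {G : Set Ω}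
    (h1 : ∀ᵐ ω ∂P, (∃ u, t ≤ u ∧ 1 < N u ω) → ω ∈ G)
    (h2 : ∀ᵐ ω ∂P, ω ∈ G → ∃ u, t ≤ u ∧ 1 ≤ N u ω) :
    P[G.indicator (fun _ => (1:ℝ)) | F t] =ᵐ[P] fun ω => min (N t ω) 1 := by
  set E := {ω | ∃ u, t ≤ u ∧ 1 < N u ω} with hE
  set E' := {ω | ∃ u, t ≤ u ∧ 1 ≤ N u ω} with hE'
  have hEm : MeasurableSet E := h.measurable_hit t
  have hEE : E =ᵐ[P] E' := by
    refine ae_eq_of_subset_of_measure_ge ?_ ?_ hEm.nullMeasurableSet (measure_ne_top _ _)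
    · rintro ω ⟨u, hu, hh⟩; exact ⟨u, hu, hh.le⟩
    · have := h.closed_le ht
      exact (ENNReal.toReal_le_toReal (measure_ne_top _ _) (measure_ne_top _ _)).1 this
  have hGE : G.indicator (fun _ => (1:ℝ)) =ᵐ[P] E.indicator (fun _ => (1:ℝ)) := by
    filter_upwards [h1, h2, hEE.mem_iff] with ω e1 e2 e3
    have : ω ∈ G ↔ ω ∈ E := ⟨fun hg => e3.2 (e2 hg), e1⟩
    by_cases hω : ω ∈ E
    · simp [hω, this.2 hω]
    · simp [hω, mt this.1 hω]
  refine (condExp_congr_ae hGE).trans (EventuallyEq.symm ?_)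
  refine ae_eq_condExp_of_forall_setIntegral_eq (F.le t) ((integrable_const _).indicator hEm)
    (fun s _ _ => (h.integrable_min t).integrableOn) (fun s hs _ => ?_) ?_
  · rw [setIntegral_ind (F.le t s hs) hEm, h.eq ht hs]
  · exact ((h.adapted t).min measurable_const).stronglyMeasurable.aestronglyMeasurable

/-- Assume `2r < σ²`. For every `x > 0` and every `t ≥ 0`, the Azéma
supermartingale of the last exit time `θ = sup{t ≥ 0 : X^x_t ≥ L}` satisfies, almost
surely, `P(θ > t | F_t) = P(sup_{u ≥ t} X^x_u ≥ L | F_t) = min{(L/X^x_t)^α, 1}`,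
where `α = 2r/σ² - 1`. -/
theorem stmt_0 {Ω : Type} [mΩ : MeasurableSpace Ω] (P : Measure Ω) [IsProbabilityMeasure P]
    (F : Filtration ℝ mΩ) (W : ℝ → Ω → ℝ) (hW : IsStdBM P F W)
    (r σ L K : ℝ) (hr : 0 < r) (hσ : 0 < σ) (hL : 0 < L) (hLK : L < K)
    (hvol : 2 * r < σ ^ 2) (x : ℝ) (hx : 0 < x) (t : ℝ) (ht : 0 ≤ t) :
    (P[Set.indicator {ω | t < sSup {s : ℝ | 0 ≤ s ∧ L ≤ GBM r σ x W s ω}}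
          (fun _ => (1 : ℝ)) | F t]
        =ᵐ[P]
      P[Set.indicator {ω | L ≤ ⨆ u : Ici t, GBM r σ x W u ω} (fun _ => (1 : ℝ)) | F t]) ∧
    (P[Set.indicator {ω | t < sSup {s : ℝ | 0 ≤ s ∧ L ≤ GBM r σ x W s ω}}
          (fun _ => (1 : ℝ)) | F t]
        =ᵐ[P] fun ω => min ((L / GBM r σ x W t ω) ^ (2 * r / σ ^ 2 - 1)) 1) := by
  set β : ℝ := 1 - 2 * r / σ ^ 2 with hβ
  have hσ2 : 0 < σ ^ 2 := by positivity
  have hβ0 : 0 < β := by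
    rw [hβ, sub_pos, div_lt_one hσ2]; exact hvol
  have hX0 : ∀ u ω, 0 < GBM r σ x W u ω := fun u ω => mul_pos hx (Real.exp_pos _)
  have hXc : ∀ ω, Continuous fun u => GBM r σ x W u ω := fun ω => by
    have := hW.cont ω
    unfold GBM; fun_prop
  have hNL : ∀ l : ℝ, 0 < l → PosCM P F (fun u ω => (GBM r σ x W u ω / l) ^ β) := by
    intro l hl
    have h1 := hW.posCM (C := (x / l) ^ β) (a := σ * β) (by positivity) (by positivity)
    have h2 : (fun (u : ℝ) (ω : Ω) => (GBM r σ x W u ω / l) ^ β) = fun u ω =>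
        (x / l) ^ β * rexp (σ * β * W u ω - (σ * β) ^ 2 / 2 * u) := by
      ext u ω
      unfold GBM
      rw [mul_div_right_comm, Real.mul_rpow (by positivity) (by positivity), ← Real.exp_mul]
      congr 2
      have : r = σ ^ 2 * (1 - β) / 2 := by rw [hβ]; field_simp; ring
      rw [this]; ring
    rw [h2]; exact h1
  have hN := hNL L hL
  have hbd : ∀ᵐ ω ∂P, ∃ T : ℝ, ∀ u, T ≤ u → GBM r σ x W u ω ≤ L / 2 := by
    filter_upwards [(hNL (L / 2) (by positivity)).ae_bdd] with ω ⟨T, hT⟩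
    refine ⟨T, fun u hu => ?_⟩
    by_contra hc
    have h1 : 1 < GBM r σ x W u ω / (L / 2) := by
      rw [one_lt_div (by positivity)]; exact not_le.1 hc
    exact absurd (hT u hu) (not_le.2 (Real.one_lt_rpow h1 hβ0))
  have hlt : ∀ u ω, 1 < (GBM r σ x W u ω / L) ^ β ↔ L < GBM r σ x W u ω := fun u ω => by
    rw [Real.one_lt_rpow_iff_of_pos (div_pos (hX0 u ω) hL), ← one_lt_div hL]
    constructor
    · rintro (h | h)
      · exact h.1
      · linarith [h.2]
    · exact fun h => Or.inl ⟨h, hβ0⟩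
  have hle : ∀ u ω, L ≤ GBM r σ x W u ω → 1 ≤ (GBM r σ x W u ω / L) ^ β := fun u ω h =>
    Real.one_le_rpow ((one_le_div hL).2 h) hβ0.le
  have hmin : (fun ω => min ((GBM r σ x W t ω / L) ^ β) 1) =
      fun ω => min ((L / GBM r σ x W t ω) ^ (2 * r / σ ^ 2 - 1)) 1 := by
    ext ω
    have : 2 * r / σ ^ 2 - 1 = -β := by rw [hβ]; ring
    rw [this, Real.rpow_neg (div_pos hL (hX0 t ω)).le,
      ← Real.inv_rpow (div_pos hL (hX0 t ω)).le, inv_div]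
  have hp := hbd.mono fun ω hω => path_incl (fun u => GBM r σ x W u ω) (hXc ω) ht
    (fun u => hX0 u ω) hω hL
  have hA := hN.ae_eq_of_between ht
    (G := {ω | t < sSup {s : ℝ | 0 ≤ s ∧ L ≤ GBM r σ x W s ω}})
    (hp.mono fun ω hω ⟨u, hu, h⟩ => hω.1 ⟨u, hu, (hlt u ω).1 h⟩)
    (hp.mono fun ω hω h => by
      obtain ⟨u, hu, h'⟩ := hω.2.1 h
      exact ⟨u, hu, hle u ω h'⟩)
  have hB := hN.ae_eq_of_between ht
    (G := {ω | L ≤ ⨆ u : Ici t, GBM r σ x W u ω})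
    (hp.mono fun ω hω ⟨u, hu, h⟩ => hω.2.2.1 ⟨u, hu, (hlt u ω).1 h⟩)
    (hp.mono fun ω hω h => by
      obtain ⟨u, hu, h'⟩ := hω.2.2.2 h
      exact ⟨u, hu, hle u ω h'⟩)
  rw [hmin] at hA hB
  exact ⟨hA.trans hB.symm, hA⟩

end
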